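/- arXiv:2203.07409 — 2 statements merged into one kernel-verified Lean document; each statement's English description precedes it below -/
import Mathlib

section
/- Let (T,[·,·,·],α) be a multiplicative Hom Lie triple system over a field k and let (V,θ,A) be a representation of T with respect to A. Then the coboundary operators of the Hom Lie triple system cochain complex satisfy δ^{2n+1} ∘ δ^{2n-1} = 0 for every n ≥ 1; in particular the spaces C^{2n+1}_{α,A}(T;V) with these coboundaries form a cochain complex. -/
/-- A `(2m+1)`-cochain of the Hom Lie triple system `(T, α)` with coefficients in
`(V, θ, A)`: a multilinear map `f : T^{2m+1} → V` such that
`A f(x₁,…,x_{2m+1}) = f(α x₁,…,α x_{2m+1})`, `f(x₁,…,x_{2m−2},x,x,y) = 0` and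
`f(x₁,…,x,y,z) + f(x₁,…,y,z,x) + f(x₁,…,z,x,y) = 0` (the last two conditions concern
the final three arguments and apply when `m ≥ 1`). -/
def IsHomLtsCochain (K : Type*) {T V : Type*} [Field K]
    [AddCommGroup T] [Module K T] [AddCommGroup V] [Module K V]
    (α : T → T) (A : V → V) (m : ℕ) (f : (Fin (2*m+1) → T) → V) : Prop :=
  (∀ (x : Fin (2*m+1) → T) (i : Fin (2*m+1)) (c : K) (u v : T),
      f (Function.update x i (c • u + v)) =
        c • f (Function.update x i u) + f (Function.update x i v)) ∧
  (∀ x, A (f x) = f fun i => α (x i)) ∧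
  (∀ x : Fin (2*m+1) → T, 1 ≤ m →
      x ⟨2*m-2, by omega⟩ = x ⟨2*m-1, by omega⟩ → f x = 0) ∧
  (∀ x : Fin (2*m+1) → T, 1 ≤ m →
      f x +
        f (fun i => if i.val = 2*m-2 then x ⟨2*m-1, by omega⟩
            else if i.val = 2*m-1 then x ⟨2*m, by omega⟩
            else if i.val = 2*m then x ⟨2*m-2, by omega⟩ else x i) +
        f (fun i => if i.val = 2*m-2 then x ⟨2*m, by omega⟩
            else if i.val = 2*m-1 then x ⟨2*m-2, by omega⟩
            else if i.val = 2*m then x ⟨2*m-1, by omega⟩ else x i) = 0)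

/-- The coboundary operator `δ^{2m+1} : C^{2m+1}_{α,A}(T;V) → C^{2m+3}_{α,A}(T;V)` of the
Hom Lie triple system cochain complex (the paper's `δ^{2n−1}` with `n = m + 1`):
`δf(x₁,…,x_{2n+1}) = θ(α^{n−1}x_{2n}, α^{n−1}x_{2n+1}) f(x₁,…,x_{2n−1})
 − θ(α^{n−1}x_{2n−1}, α^{n−1}x_{2n+1}) f(x₁,…,x_{2n−2},x_{2n})
 + Σ_{k=1}^{n} (−1)^{k+n} D(α^{n−1}x_{2k−1}, α^{n−1}x_{2k}) f(…,x̂_{2k−1},x̂_{2k},…)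
 + Σ_{k=1}^{n} Σ_{j=2k+1}^{2n+1} (−1)^{n+k+1}
     f(αx₁,…,x̂_{2k−1},x̂_{2k},…,[x_{2k−1} x_{2k} x_j],…,αx_{2n+1})`,
where `D(a,b) = θ(b,a) − θ(a,b)` and positions are 1-based. -/
noncomputable def homLtsCoboundary (K : Type*) {T V : Type*} [Field K]
    [AddCommGroup T] [Module K T] [AddCommGroup V] [Module K V]
    (br : T → T → T → T) (α : T → T) (θ : T → T → V → V)
    (m : ℕ) (f : (Fin (2*m+1) → T) → V) :
    (Fin (2*m+3) → T) → V := fun x =>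
  let N : ℕ := m + 1
  let X : ℕ → T := fun p => if h : p - 1 < 2*m+3 then x ⟨p-1, h⟩ else 0
  let D : T → T → V → V := fun a b v => θ b a v - θ a b v
  θ (α^[N-1] (X (2*N))) (α^[N-1] (X (2*N+1))) (f fun i => X (i.val+1))
    - θ (α^[N-1] (X (2*N-1))) (α^[N-1] (X (2*N+1)))
        (f fun i => if i.val+1 ≤ 2*N-2 then X (i.val+1) else X (2*N))
    + ∑ k ∈ Finset.Icc 1 N, ((-1 : K))^(k+N) •
        D (α^[N-1] (X (2*k-1))) (α^[N-1] (X (2*k)))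
          (f fun i => X (if i.val+1 ≤ 2*k-2 then i.val+1 else i.val+3))
    + ∑ k ∈ Finset.Icc 1 N, ∑ j ∈ Finset.Icc (2*k+1) (2*N+1),
        ((-1 : K))^(N+k+1) •
          f (fun i =>
            if (if i.val+1 ≤ 2*k-2 then i.val+1 else i.val+3) = j
            then br (X (2*k-1)) (X (2*k)) (X j)
            else α (X (if i.val+1 ≤ 2*k-2 then i.val+1 else i.val+3)))


namespace HomLtsAux

section alg
variable {K T V : Type*} [Field K] [AddCommGroup T] [Module K T] [AddCommGroup V] [Module K V]

/-- Prefix a pair to the argument list. -/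
def cns (X : T × T) (f : List (T × T) → T → V) : List (T × T) → T → V := fun l => f (X :: l)

/-- Apply `α` to both entries of a pair. -/
def am (α : T →ₗ[K] T) (X : T × T) : T × T := (α X.1, α X.2)

/-- Composition of a cochain with `α` in each argument. -/
def pb (α : T →ₗ[K] T) (f : List (T × T) → T → V) : List (T × T) → T → V :=
  fun l z => f (l.map (am α)) (α z)

/-- Sum over all slots, `φ` in one slot and `α` in the others. -/
def S (α φ : T →ₗ[K] T) : List (T × T) → (List (T × T) → T → V) → T → V
  | [], g, z => g [] (φ z)
  | Y :: l, g, z => S α φ l (cns (am α Y) g) z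
      + pb α (cns (φ Y.1, α Y.2) g) l z + pb α (cns (α Y.1, φ Y.2) g) l z

/-- The two special terms of the coboundary. -/
def tp (θ : T →ₗ[K] T →ₗ[K] V →ₗ[K] V) (β : T →ₗ[K] T) (X : T × T)
    (f : List (T × T) → T → V) : List (T × T) → T → V
  | [], z => θ (β X.2) (β z) (f [] X.1) - θ (β X.1) (β z) (f [] X.2)
  | _ :: _, _ => 0

/-- The operator `D(a,b)`. -/
def Dop (θ : T →ₗ[K] T →ₗ[K] V →ₗ[K] V) (X : T × T) : V →ₗ[K] V := θ X.2 X.1 - θ X.1 X.2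

/-- Lie derivative. -/
def L (α φ : T →ₗ[K] T) (E : V →ₗ[K] V) (f g : List (T × T) → T → V) : List (T × T) → T → V :=
  fun l z => E (f l z) - S α φ l g z

/-- The (normalised) coboundary. -/
def d (br : T →ₗ[K] T →ₗ[K] T →ₗ[K] T) (α : T →ₗ[K] T) (θ : T →ₗ[K] T →ₗ[K] V →ₗ[K] V)
    (β : T →ₗ[K] T) :
    List (T × T) → (List (T × T) → T → V) → (List (T × T) → T → V) → T → V
  | [], _, _, _ => 0
  | X :: l, f, g, z => L α (br X.1 X.2) (Dop θ (am β X)) f g l z + tp θ β X f l z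
      - d br α θ β l (cns X f) (cns (am α X) g) z

/-- Additivity in each slot. -/
def Ad (f : List (T × T) → T → V) : Prop :=
  (∀ l u v, f l (u + v) = f l u + f l v) ∧
  (∀ l₁ l₂ a a' b z, f (l₁ ++ (a + a', b) :: l₂) z
    = f (l₁ ++ (a, b) :: l₂) z + f (l₁ ++ (a', b) :: l₂) z) ∧
  (∀ l₁ l₂ a b b' z, f (l₁ ++ (a, b + b') :: l₂) z
    = f (l₁ ++ (a, b) :: l₂) z + f (l₁ ++ (a, b') :: l₂) z)

lemma Ad.cns {f : List (T × T) → T → V} (hf : Ad f) (X : T × T) : Ad (cns X f) :=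
  ⟨fun l u v => hf.1 (X :: l) u v, fun l₁ l₂ => hf.2.1 (X :: l₁) l₂,
    fun l₁ l₂ => hf.2.2 (X :: l₁) l₂⟩

lemma S_add (α φ : T →ₗ[K] T) (l : List (T × T)) : ∀ (g g' : List (T × T) → T → V) (z : T),
    S α φ l (g + g') z = S α φ l g z + S α φ l g' z := by
  induction l with
  | nil => intro g g' z; simp [S]
  | cons Y l ih =>
    intro g g' z
    have e : cns (am α Y) (g + g') = cns (am α Y) g + cns (am α Y) g' := rfl
    simp only [S, e, ih]
    simp only [pb, cns, Pi.add_apply]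
    abel

lemma S_lin (α φ : T →ₗ[K] T) (E : V →ₗ[K] V) (l : List (T × T)) :
    ∀ (g : List (T × T) → T → V) (z : T),
    S α φ l (fun l z => E (g l z)) z = E (S α φ l g z) := by
  induction l with
  | nil => intro g z; simp [S]
  | cons Y l ih =>
    intro g z
    have := ih (cns (am α Y) g) z
    simp only [S, map_add, ← this]
    rfl

lemma S_smul (α φ : T →ₗ[K] T) (c : K) (l : List (T × T))
    (g : List (T × T) → T → V) (z : T) : S α φ l (c • g) z = c • S α φ l g z :=
  S_lin α φ (c • LinearMap.id) l g z

lemma S_sub (α φ : T →ₗ[K] T) (l : List (T × T)) (g g' : List (T × T) → T → V) (z : T) :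
    S α φ l (g - g') z = S α φ l g z - S α φ l g' z := by
  have := S_add α φ l (g - g') g' z
  rw [sub_add_cancel] at this
  rw [this]; abel

lemma S_zero (α φ : T →ₗ[K] T) (l : List (T × T)) (z : T) :
    S α φ l (0 : List (T × T) → T → V) z = 0 := by
  have := S_add α φ l (0 : List (T × T) → T → V) 0 z
  simpa using this

lemma S_pb (α φ φ' : T →ₗ[K] T) (h : ∀ z, φ' (α z) = α (φ z)) (l : List (T × T)) :
    ∀ (k : List (T × T) → T → V) (z : T),
    S α φ l (pb α k) z = S α φ' (l.map (am α)) k (α z) := by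
  induction l with
  | nil => intro k z; simp [S, pb, h]
  | cons Y l ih =>
    intro k z
    have e : cns (am α Y) (pb α k) = pb α (cns (am α (am α Y)) k) := rfl
    simp only [S, e, ih, List.map_cons]
    simp [pb, cns, am, h]

lemma S_S (α φ ψ φ' ψ' χ : T →ₗ[K] T) (hφ : ∀ z, φ' (α z) = α (φ z))
    (hψ : ∀ z, ψ' (α z) = α (ψ z)) (hχ : ∀ z, φ' (ψ z) = χ (α z) + ψ' (φ z))
    (l : List (T × T)) : ∀ (h : List (T × T) → T → V) (_ : Ad h) (z : T),
    S α ψ l (fun l z => S α φ' l h z) z = S α χ (l.map (am α)) h (α z)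
      + S α φ l (fun l z => S α ψ' l h z) z := by
  induction l with
  | nil => intro h hh z; simp [S, hχ, hh.1]
  | cons Z l ih =>
    intro h hh z
    have e : ∀ φ : T →ₗ[K] T, cns (am α Z) (fun l z => S α φ l h z)
        = (fun l z => S α φ l (cns (am α (am α Z)) h) z)
        + (pb α (cns (φ (α Z.1), α (α Z.2)) h) + pb α (cns (α (α Z.1), φ (α Z.2)) h)) := by
      intro φ; funext l z; simp [cns, S, am, add_assoc]
    have e1 := hh.2.1 []
    have e2 := hh.2.2 []
    simp only [List.nil_append] at e1 e2
    simp only [S, e, S_add, ih _ (hh.cns _), List.map_cons, S_pb α φ φ' hφ, S_pb α ψ ψ' hψ]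
    simp only [pb, cns, S, am, hφ, hψ, hχ, e1, e2]
    abel

lemma tp_add (θ : T →ₗ[K] T →ₗ[K] V →ₗ[K] V) (β : T →ₗ[K] T) (X : T × T)
    (f f' : List (T × T) → T → V) (l : List (T × T)) (z : T) :
    tp θ β X (f + f') l z = tp θ β X f l z + tp θ β X f' l z := by
  cases l <;> simp [tp]; abel

lemma tp_smul (θ : T →ₗ[K] T →ₗ[K] V →ₗ[K] V) (β : T →ₗ[K] T) (X : T × T) (c : K)
    (f : List (T × T) → T → V) (l : List (T × T)) (z : T) :
    tp θ β X (c • f) l z = c • tp θ β X f l z := by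
  cases l <;> simp [tp, smul_sub]

variable (br : T →ₗ[K] T →ₗ[K] T →ₗ[K] T) (α : T →ₗ[K] T) (θ : T →ₗ[K] T →ₗ[K] V →ₗ[K] V)

lemma d_add (β : T →ₗ[K] T) (l : List (T × T)) : ∀ (f f' g g' : List (T × T) → T → V) (z : T),
    d br α θ β l (f + f') (g + g') z = d br α θ β l f g z + d br α θ β l f' g' z := by
  induction l with
  | nil => intros; simp [d]
  | cons X l ih =>
    intro f f' g g' z
    have e : ∀ X (g g' : List (T × T) → T → V), cns X (g + g') = cns X g + cns X g' :=
      fun _ _ _ => rfl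
    simp only [d, e, ih, L, S_add, tp_add, Pi.add_apply, map_add]
    abel

lemma d_smul (β : T →ₗ[K] T) (c : K) (l : List (T × T)) :
    ∀ (f g : List (T × T) → T → V) (z : T),
    d br α θ β l (c • f) (c • g) z = c • d br α θ β l f g z := by
  induction l with
  | nil => intros; simp [d]
  | cons X l ih =>
    intro f g z
    have e : ∀ X (g : List (T × T) → T → V), cns X (c • g) = c • cns X g :=
      fun _ _ => rfl
    simp only [d, e, ih, L, S_smul, tp_smul, Pi.smul_apply, map_smul, smul_sub, smul_add]

lemma d_sub (β : T →ₗ[K] T) (l : List (T × T)) (f f' g g' : List (T × T) → T → V) (z : T) :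
    d br α θ β l (f - f') (g - g') z = d br α θ β l f g z - d br α θ β l f' g' z := by
  have := d_add br α θ β l (f - f') f' (g - g') g' z
  rw [sub_add_cancel, sub_add_cancel] at this
  rw [this]; abel

lemma d_zero (β : T →ₗ[K] T) (l : List (T × T)) (z : T) :
    d br α θ β l (0 : List (T × T) → T → V) 0 z = 0 := by
  have := d_add br α θ β l (0 : List (T × T) → T → V) 0 0 0 z
  simpa using this

lemma d_pb (hTmul : ∀ a b c, α (br a b c) = br (α a) (α b) (α c))
    (β : T →ₗ[K] T) (l : List (T × T)) : ∀ (f g : List (T × T) → T → V) (z : T),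
    d br α θ (β ∘ₗ α) l (pb α f) (pb α g) z = d br α θ β (l.map (am α)) f g (α z) := by
  induction l with
  | nil => intros; simp [d]
  | cons X l ih =>
    intro f g z
    have e : ∀ Y (g : List (T × T) → T → V), cns Y (pb α g) = pb α (cns (am α Y) g) :=
      fun _ _ => rfl
    have t : tp θ (β ∘ₗ α) X (pb α f) l z = tp θ β (am α X) f (l.map (am α)) (α z) := by
      cases l <;> simp [tp, pb, am]
    simp only [d, e, ih, L, List.map_cons, t]
    rw [S_pb α (br X.1 X.2) (br (am α X).1 (am α X).2) (fun z => (hTmul _ _ _).symm)]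
    rfl

lemma L_L (φ ψ φ' ψ' χ : T →ₗ[K] T) (hφ : ∀ z, φ' (α z) = α (φ z))
    (hψ : ∀ z, ψ' (α z) = α (ψ z)) (hχ : ∀ z, φ' (ψ z) = χ (α z) + ψ' (φ z))
    (A E F E' F' G : V →ₗ[K] V) (hE : ∀ v, E' (F v) = F' (E v) + G (A v))
    (f g h : List (T × T) → T → V) (hh : Ad h)
    (hfg : ∀ l z, A (f l z) = g (l.map (am α)) (α z)) (l : List (T × T)) (z : T) :
    L α φ E' (L α ψ F f g) (L α ψ' F' g h) l z
      = L α ψ F' (L α φ E f g) (L α φ' E' g h) l z + L α χ G g h (l.map (am α)) (α z) := by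
  have e : ∀ (E : V →ₗ[K] V) (φ : T →ₗ[K] T), L α φ E g h
      = (fun l z => E (g l z)) - (fun l z => S α φ l h z) := fun _ _ => rfl
  simp only [e, Pi.sub_apply]
  simp only [L, S_sub, S_lin, map_sub, hE, hfg, S_S α φ ψ φ' ψ' χ hφ hψ hχ l h hh z]
  abel

lemma S_addφ (φ ψ : T →ₗ[K] T) (l : List (T × T)) :
    ∀ (h : List (T × T) → T → V) (_ : Ad h) (z : T),
    S α (φ + ψ) l h z = S α φ l h z + S α ψ l h z := by
  induction l with
  | nil => intro h hh z; simp [S, hh.1]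
  | cons Y l ih =>
    intro h hh z
    have e1 := hh.2.1 []
    have e2 := hh.2.2 []
    simp only [List.nil_append] at e1 e2
    simp only [S, ih _ (hh.cns _)]
    simp only [pb, cns, LinearMap.add_apply, e1, e2]
    abel

lemma L_add (φ : T →ₗ[K] T) (E : V →ₗ[K] V) (f f' g g' : List (T × T) → T → V)
    (l : List (T × T)) (z : T) :
    L α φ E (f + f') (g + g') l z = L α φ E f g l z + L α φ E f' g' l z := by
  simp only [L, S_add, Pi.add_apply, map_add]; abel

lemma L_sub (φ : T →ₗ[K] T) (E : V →ₗ[K] V) (f f' g g' : List (T × T) → T → V)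
    (l : List (T × T)) (z : T) :
    L α φ E (f - f') (g - g') l z = L α φ E f g l z - L α φ E f' g' l z := by
  simp only [L, S_sub, Pi.sub_apply, map_sub]; abel

lemma L_zero (φ : T →ₗ[K] T) (E : V →ₗ[K] V) (l : List (T × T)) (z : T) :
    L α φ E (0 : List (T × T) → T → V) 0 l z = 0 := by
  simp [L, S_zero]

lemma L_cns (φ : T →ₗ[K] T) (E : V →ₗ[K] V) (f g : List (T × T) → T → V) (Y : T × T) :
    cns Y (L α φ E f g) = L α φ E (cns Y f) (cns (am α Y) g)
      - (pb α (cns (φ Y.1, α Y.2) g) + pb α (cns (α Y.1, φ Y.2) g)) := by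
  funext l z
  simp only [cns, L, S, Pi.sub_apply, Pi.add_apply]
  abel

/-- The coboundary as a cochain. -/
def dC (β : T →ₗ[K] T) (f g : List (T × T) → T → V) : List (T × T) → T → V :=
  fun l z => d br α θ β l f g z

lemma dC_cns (β : T →ₗ[K] T) (f g : List (T × T) → T → V) (Y : T × T) :
    cns Y (dC br α θ β f g) = L α (br Y.1 Y.2) (Dop θ (am β Y)) f g + tp θ β Y f
      - dC br α θ β (cns Y f) (cns (am α Y) g) := by
  funext l z
  simp only [cns, dC, d, Pi.sub_apply, Pi.add_apply]

lemma tp_cons (β : T →ₗ[K] T) (X Y : T × T) (f : List (T × T) → T → V) :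
    cns Y (tp θ β X f) = 0 := rfl

lemma L_tp (hTmul : ∀ a b c, α (br a b c) = br (α a) (α b) (α c))
    (A : V →ₗ[K] V)
    (hR3 : ∀ a b c d v,
      θ (α c) (α d) (θ b a v - θ a b v) -
          (θ (α b) (α a) (θ c d v) - θ (α a) (α b) (θ c d v)) +
        θ (br a b c) (α d) (A v) + θ (α c) (br a b d) (A v) = 0)
    (β : T →ₗ[K] T) (hβα : ∀ z, β (α z) = α (β z))
    (hβ : ∀ a b c, β (br a b c) = br (β a) (β b) (β c))
    (f g : List (T × T) → T → V)
    (hfg : ∀ l z, A (f l z) = g (l.map (am α)) (α z)) (X Y : T × T)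
    (l : List (T × T)) (z : T) :
    L α (br X.1 X.2) (Dop θ (am (β ∘ₗ α) X)) (tp θ β Y f) (tp θ β (am α Y) g) l z
      = tp θ (β ∘ₗ α) Y (L α (br X.1 X.2) (Dop θ (am β X)) f g) l z
        + (tp θ β (br X.1 X.2 Y.1, α Y.2) g (l.map (am α)) (α z)
          + tp θ β (α Y.1, br X.1 X.2 Y.2) g (l.map (am α)) (α z)) := by
  cases l with
  | nil =>
    have h1 := hR3 (β X.1) (β X.2) (β Y.2) (β z) (f [] Y.1)
    have h2 := hR3 (β X.1) (β X.2) (β Y.1) (β z) (f [] Y.2)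
    have h3 := hfg [] Y.1
    have h4 := hfg [] Y.2
    simp only [List.map_nil] at h3 h4
    rw [h3] at h1
    rw [h4] at h2
    simp only [map_sub] at h1 h2
    rw [← sub_eq_zero]
    simp only [L, tp, S, Dop, am, LinearMap.sub_apply, LinearMap.comp_apply, hβα, hβ, map_sub,
      List.map_nil]
    rw [← sub_eq_zero_of_eq (h2.trans h1.symm)]
    abel
  | cons Z l =>
    have e : L α (br X.1 X.2) (Dop θ (am (β ∘ₗ α) X)) (tp θ β Y f) (tp θ β (am α Y) g) (Z :: l) z
        = cns Z (L α (br X.1 X.2) (Dop θ (am (β ∘ₗ α) X)) (tp θ β Y f) (tp θ β (am α Y) g)) l z :=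
      rfl
    rw [e, L_cns, tp_cons, tp_cons, tp_cons, tp_cons]
    simp only [Pi.sub_apply, L_zero, tp, List.map_cons]
    simp [pb]

lemma L_d 
    (hT3 : ∀ a b c d e, br (α a) (α b) (br c d e) =
      br (br a b c) (α d) (α e) + br (α c) (br a b d) (α e) +
        br (α c) (α d) (br a b e))
    (hTmul : ∀ a b c, α (br a b c) = br (α a) (α b) (α c))
    (A : V →ₗ[K] V)
    (hR3 : ∀ a b c d v,
      θ (α c) (α d) (θ b a v - θ a b v) -
          (θ (α b) (α a) (θ c d v) - θ (α a) (α b) (θ c d v)) +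
        θ (br a b c) (α d) (A v) + θ (α c) (br a b d) (A v) = 0)
    (β : T →ₗ[K] T) (hβα : ∀ z, β (α z) = α (β z))
    (hβ : ∀ a b c, β (br a b c) = br (β a) (β b) (β c)) (X : T × T)
    (l : List (T × T)) : ∀ (f g h : List (T × T) → T → V) (_ : Ad h)
    (_ : ∀ l z, A (f l z) = g (l.map (am α)) (α z)) (z : T),
    L α (br X.1 X.2) (Dop θ (am (β ∘ₗ α) X)) (dC br α θ β f g) (dC br α θ β g h) l z
      = d br α θ (β ∘ₗ α) l (L α (br X.1 X.2) (Dop θ (am β X)) f g)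
          (L α (br (α X.1) (α X.2)) (Dop θ (am (β ∘ₗ α) X)) g h) z := by
  induction l with
  | nil => intro f g h _ _ z; simp [L, S, dC, d]
  | cons Y l ih =>
    intro f g h hh hfg z
    have e : ∀ f g : List (T × T) → T → V,
        L α (br X.1 X.2) (Dop θ (am (β ∘ₗ α) X)) f g (Y :: l) z
        = cns Y (L α (br X.1 X.2) (Dop θ (am (β ∘ₗ α) X)) f g) l z := fun _ _ => rfl
    have hh' := hh.cns (am α (am α Y))
    have hfg' : ∀ l z, A (cns Y f l z) = cns (am α Y) g (l.map (am α)) (α z) :=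
      fun l z => hfg (Y :: l) z
    have key := L_L α (br X.1 X.2) (br Y.1 Y.2) (br (α X.1) (α X.2)) (br (α Y.1) (α Y.2))
      (br (br X.1 X.2 Y.1) (α Y.2) + br (α Y.1) (br X.1 X.2 Y.2))
      (fun z => (hTmul _ _ _).symm) (fun z => (hTmul _ _ _).symm)
      (fun z => hT3 _ _ _ _ _) A
      (Dop θ (am β X)) (Dop θ (am β Y)) (Dop θ (am (β ∘ₗ α) X)) (Dop θ (am (β ∘ₗ α) Y))
      (Dop θ (am β (br X.1 X.2 Y.1, α Y.2)) + Dop θ (am β (α Y.1, br X.1 X.2 Y.2)))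
      (fun v => by
        have h1 := hR3 (β X.1) (β X.2) (β Y.1) (β Y.2) v
        have h2 := hR3 (β X.1) (β X.2) (β Y.2) (β Y.1) v
        simp only [map_sub] at h1 h2
        rw [← sub_eq_zero]
        simp only [Dop, am, LinearMap.sub_apply, LinearMap.add_apply, LinearMap.comp_apply,
          hβα, hβ, map_sub]
        rw [← sub_eq_zero_of_eq (h1.trans h2.symm)]
        abel) f g h hh hfg l z
    have key2 : ∀ l z, L α (br (br X.1 X.2 Y.1) (α Y.2) + br (α Y.1) (br X.1 X.2 Y.2))
        (Dop θ (am β (br X.1 X.2 Y.1, α Y.2)) + Dop θ (am β (α Y.1, br X.1 X.2 Y.2))) g h l z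
        = L α (br (br X.1 X.2 Y.1) (α Y.2)) (Dop θ (am β (br X.1 X.2 Y.1, α Y.2))) g h l z
        + L α (br (α Y.1) (br X.1 X.2 Y.2)) (Dop θ (am β (α Y.1, br X.1 X.2 Y.2))) g h l z := by
      intro l z
      simp only [L, S_addφ _ _ _ _ _ hh, LinearMap.add_apply]
      abel
    have key3 := L_tp br α θ hTmul A hR3 β hβα hβ f g hfg X Y l z
    have ih' := ih _ _ _ hh' hfg' z
    rw [e, L_cns, d, dC_cns, dC_cns, dC_cns, dC_cns, L_cns, L_cns, d_sub, d_add]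
    simp only [Pi.sub_apply, Pi.add_apply, L_sub, L_add]
    have e1 : (br (α X.1) (α X.2) (am α Y).1, α (am α Y).2) = am α (br X.1 X.2 Y.1, α Y.2) := by
      simp [am, hTmul]
    have e2 : (α (am α Y).1, br (α X.1) (α X.2) (am α Y).2) = am α (α Y.1, br X.1 X.2 Y.2) := by
      simp [am, hTmul]
    rw [e1, e2, d_pb br α θ hTmul, d_pb br α θ hTmul, ih', key3]
    change L α (br X.1 X.2) (Dop θ (am (β ∘ₗ α) X)) 
      (L α (br Y.1 Y.2) (Dop θ (am β Y)) f g)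
      (L α (br (α Y.1) (α Y.2)) (Dop θ (am (β ∘ₗ α) Y)) g h) l z + _ - _ - _ = _
    rw [key, key2]
    simp only [pb, Pi.sub_apply, Pi.add_apply, dC]
    abel

lemma d_tp (A : V →ₗ[K] V)
    (hR2 : ∀ a b c d v,
      θ (α c) (α d) (θ a b v) - θ (α b) (α d) (θ a c v) -
          θ (α a) (br b c d) (A v) +
        (θ (α c) (α b) (θ a d v) - θ (α b) (α c) (θ a d v)) = 0)
    (β : T →ₗ[K] T) (hβα : ∀ z, β (α z) = α (β z))
    (hβ : ∀ a b c, β (br a b c) = br (β a) (β b) (β c))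
    (f g : List (T × T) → T → V)
    (hfg : ∀ l z, A (f l z) = g (l.map (am α)) (α z)) (X : T × T)
    (l : List (T × T)) (z : T) :
    d br α θ (β ∘ₗ α) l (tp θ β X f) (tp θ β (am α X) g) z = 0 := by
  cases l with
  | nil => rfl
  | cons Y l =>
    rw [d, tp_cons, tp_cons, d_zero, sub_zero]
    cases l with
    | nil =>
      have h1 := hR2 (β X.2) (β Y.1) (β Y.2) (β z) (f [] X.1)
      have h2 := hR2 (β X.1) (β Y.1) (β Y.2) (β z) (f [] X.2)
      have h3 := hfg [] X.1
      have h4 := hfg [] X.2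
      simp only [List.map_nil] at h3 h4
      rw [h3] at h1
      rw [h4] at h2
      simp only [L, tp, S, Dop, am, LinearMap.sub_apply, LinearMap.comp_apply, hβα, hβ, map_sub]
      rw [← sub_eq_zero_of_eq (h1.trans h2.symm)]
      abel
    | cons Z l =>
      have e : ∀ φ E, L α φ E (tp θ β X f) (tp θ β (am α X) g) (Z :: l) z
        = cns Z (L α φ E (tp θ β X f) (tp θ β (am α X) g)) l z := fun _ _ => rfl
      rw [e, L_cns, tp_cons, tp_cons, tp_cons, tp_cons]
      simp only [Pi.sub_apply, L_zero, tp]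
      simp [pb]

lemma d_d
    (hT3 : ∀ a b c d e, br (α a) (α b) (br c d e) =
      br (br a b c) (α d) (α e) + br (α c) (br a b d) (α e) +
        br (α c) (α d) (br a b e))
    (hTmul : ∀ a b c, α (br a b c) = br (α a) (α b) (α c))
    (A : V →ₗ[K] V)
    (hR2 : ∀ a b c d v,
      θ (α c) (α d) (θ a b v) - θ (α b) (α d) (θ a c v) -
          θ (α a) (br b c d) (A v) +
        (θ (α c) (α b) (θ a d v) - θ (α b) (α c) (θ a d v)) = 0)
    (hR3 : ∀ a b c d v,
      θ (α c) (α d) (θ b a v - θ a b v) -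
          (θ (α b) (α a) (θ c d v) - θ (α a) (α b) (θ c d v)) +
        θ (br a b c) (α d) (A v) + θ (α c) (br a b d) (A v) = 0)
    (β : T →ₗ[K] T) (hβα : ∀ z, β (α z) = α (β z))
    (hβ : ∀ a b c, β (br a b c) = br (β a) (β b) (β c))
    (l : List (T × T)) : ∀ (f g h : List (T × T) → T → V) (_ : Ad h)
    (_ : ∀ l z, A (f l z) = g (l.map (am α)) (α z)) (z : T),
    d br α θ (β ∘ₗ α) l (dC br α θ β f g) (dC br α θ β g h) z = 0 := by
  induction l with
  | nil => intros; rfl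
  | cons X l ih =>
    intro f g h hh hfg z
    have hfg' : ∀ l z, A (cns X f l z) = cns (am α X) g (l.map (am α)) (α z) :=
      fun l z => hfg (X :: l) z
    have t : tp θ (β ∘ₗ α) X (dC br α θ β f g) l z = 0 := by
      cases l <;> simp [tp, dC, d]
    rw [d, t, L_d br α θ hT3 hTmul A hR3 β hβα hβ X l f g h hh hfg z, dC_cns, dC_cns, d_sub,
      ih _ _ _ (hh.cns _) hfg', d_add, d_tp br α θ A hR2 β hβα hβ f g hfg]
    simp only [am, LinearMap.comp_apply]
    abel

/-- Prefix a pair to a sequence. -/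
def cons2 (X : T × T) (s : ℕ → T) : ℕ → T
  | 0 => X.1
  | 1 => X.2
  | n + 2 => s n

/-- The sequence of entries of a list of pairs followed by a last element. -/
def flat : List (T × T) → T → ℕ → T
  | [], z => fun _ => z
  | X :: l, z => cons2 X (flat l z)

/-- Explicit form of the coboundary on sequences. -/
def EE (β : T →ₗ[K] T) (n : ℕ) (F G : (ℕ → T) → V) (X : ℕ → T) : V :=
  θ (β (X (2*n+1))) (β (X (2*n+2))) (F X)
    - θ (β (X (2*n))) (β (X (2*n+2))) (F fun i => if i < 2*n then X i else X (2*n+1))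
    + ∑ k ∈ Finset.range (n+1), ((-1 : K))^(k+n) •
        Dop θ (am β (X (2*k), X (2*k+1))) (F fun i => X (if i < 2*k then i else i+2))
    + ∑ k ∈ Finset.range (n+1), ∑ j ∈ Finset.range (2*(n-k)+1), ((-1 : K))^(n+k+1) •
        G (fun i => if (if i < 2*k then i else i+2) = 2*k+2+j
            then br (X (2*k)) (X (2*k+1)) (X (2*k+2+j))
            else α (X (if i < 2*k then i else i+2)))

/-- Extension of a cochain to lists. -/
def hat (n : ℕ) (F : (ℕ → T) → V) : List (T × T) → T → V :=
  fun l z => if l.length = n then F (flat l z) else 0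

/-- Dependence only on the first `2n+1` entries. -/
def Dep (n : ℕ) (F : (ℕ → T) → V) : Prop :=
  ∀ s t : ℕ → T, (∀ i < 2*n+1, s i = t i) → F s = F t

lemma Dep.cons {n : ℕ} {F : (ℕ → T) → V} (h : Dep (n+1) F) (X : T × T) :
    Dep n (fun s => F (cons2 X s)) := by
  intro s t hst
  apply h
  intro i hi
  match i with
  | 0 => rfl
  | 1 => rfl
  | i + 2 => exact hst i (by omega)

lemma hat_cns (n : ℕ) (F : (ℕ → T) → V) (X : T × T) :
    cns X (hat (n+1) F) = hat n (fun s => F (cons2 X s)) := by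
  funext l z
  simp [cns, hat, flat]

lemma flat_map (l : List (T × T)) (z : T) :
    flat (l.map (am α)) (α z) = fun i => α (flat l z i) := by
  induction l with
  | nil => rfl
  | cons X l ih =>
    funext i
    match i with
    | 0 => rfl
    | 1 => rfl
    | i + 2 => exact congrFun ih i

lemma S_hat (φ : T →ₗ[K] T) (l : List (T × T)) : ∀ (n : ℕ) (_ : l.length = n)
    (G : (ℕ → T) → V) (_ : Dep n G) (z : T),
    S α φ l (hat n G) z = ∑ j ∈ Finset.range (2*n+1),
      G (fun i => if i = j then φ (flat l z i) else α (flat l z i)) := by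
  induction l with
  | nil =>
    intro n hn G hG z
    subst hn
    simp only [S, hat, List.length_nil, if_true, Nat.mul_zero, Nat.zero_add, Finset.sum_range_one]
    apply hG
    intro i hi
    have : i = 0 := by simpa using hi
    subst this
    simp [flat]
  | cons Y l ih =>
    intro n hn G hG z
    obtain ⟨n, rfl⟩ : ∃ k, n = k + 1 := ⟨l.length, by simp [← hn]⟩
    have hl : l.length = n := by simpa using hn
    rw [show 2*(n+1)+1 = (2*n+1)+1+1 by ring, Finset.sum_range_succ', Finset.sum_range_succ']
    simp only [S, hat_cns, ih n hl _ (hG.cons _)]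
    rw [add_right_comm]
    congr 1
    · congr 1
      · apply Finset.sum_congr rfl
        intro j _
        congr 1
        funext i
        match i with
        | 0 => simp [flat, cons2, am]
        | 1 => simp [flat, cons2, am]
        | i + 2 => simp [flat, cons2]
      · simp only [pb, hat, List.length_map, hl, if_true, flat_map]
        congr 1
        funext i
        match i with
        | 0 => simp [flat, cons2]
        | 1 => simp [flat, cons2]
        | i + 2 => simp [flat, cons2]
    · simp only [pb, hat, List.length_map, hl, if_true, flat_map]
      congr 1
      funext i
      match i with
      | 0 => simp [flat, cons2]
      | 1 => simp [flat, cons2]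
      | i + 2 => simp [flat, cons2]

lemma EE_succ (β : T →ₗ[K] T) (n : ℕ) (F G : (ℕ → T) → V) (X : T × T) (s : ℕ → T) :
    EE br α θ β (n+1) F G (cons2 X s)
      = (-1 : K)^(n+1) • (Dop θ (am β X) (F s) - ∑ j ∈ Finset.range (2*(n+1)+1),
          G (fun i => if i = j then br X.1 X.2 (s i) else α (s i)))
        + EE br α θ β n (fun s => F (cons2 X s)) (fun s => G (cons2 (am α X) s)) s := by
  unfold EE
  rw [Finset.sum_range_succ' _ (n+1), Finset.sum_range_succ' _ (n+1)]
  have h1 : (F fun i => if i < 2*(n+1) then cons2 X s i else cons2 X s (2*(n+1)+1))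
      = F (cons2 X (fun i => if i < 2*n then s i else s (2*n+1))) := by
    congr 1
    funext i
    match i with
    | 0 => simp [cons2]
    | 1 =>
      change (if 1 < 2*(n+1) then X.2 else _) = X.2
      rw [if_pos (by omega)]
    | i + 2 =>
      have : i + 2 < 2*(n+1) ↔ i < 2*n := by omega
      simp only [this]
      rfl
  have h2 : ∀ k, (F fun i => cons2 X s (if i < 2*(k+1) then i else i+2))
      = F (cons2 X (fun i => s (if i < 2*k then i else i+2))) := by
    intro k
    congr 1
    funext i
    match i with
    | 0 => simp [cons2]
    | 1 =>
      change cons2 X s (if 1 < 2*(k+1) then 1 else 1+2) = X.2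
      rw [if_pos (by omega)]
      rfl
    | i + 2 =>
      have : i + 2 < 2*(k+1) ↔ i < 2*k := by omega
      simp only [this]
      by_cases h : i < 2*k
      · simp only [h, if_true, cons2]
      · simp only [h, if_false, cons2]
  have h3 : ∀ k j, (G fun i => if (if i < 2*(k+1) then i else i+2) = 2*(k+1)+2+j
            then br (cons2 X s (2*(k+1))) (cons2 X s (2*(k+1)+1)) (cons2 X s (2*(k+1)+2+j))
            else α (cons2 X s (if i < 2*(k+1) then i else i+2)))
      = G (cons2 (am α X) (fun i => if (if i < 2*k then i else i+2) = 2*k+2+j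
            then br (s (2*k)) (s (2*k+1)) (s (2*k+2+j))
            else α (s (if i < 2*k then i else i+2)))) := by
    intro k j
    congr 1
    funext i
    match i with
    | 0 =>
      have a : (if 0 < 2*(k+1) then 0 else 0+2) = 0 := if_pos (by omega)
      rw [a, if_neg (by omega)]; rfl
    | 1 =>
      have a : (if 1 < 2*(k+1) then 1 else 1+2) = 1 := if_pos (by omega)
      rw [a, if_neg (by omega)]; rfl
    | i + 2 =>
      have c : ∀ p, cons2 X s (p+2) = s p := fun _ => rfl
      have e0 : 2*(k+1) = 2*k+2 := by ring
      have e1 : 2*(k+1)+1 = (2*k+1)+2 := by ring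
      have e : 2*(k+1)+2+j = (2*k+2+j)+2 := by ring
      have a : (if i + 2 < 2*(k+1) then i+2 else i+2+2) = (if i < 2*k then i else i+2) + 2 := by
        split_ifs <;> omega
      rw [a, e, e1, e0, c, c, c, c]
      change _ = (if (if i < 2*k then i else i+2) = 2*k+2+j
            then br (s (2*k)) (s (2*k+1)) (s (2*k+2+j))
            else α (s (if i < 2*k then i else i+2)))
      by_cases h : (if i < 2*k then i else i+2) = 2*k+2+j
      · rw [if_pos h, if_pos (by omega)]
      · rw [if_neg h, if_neg (by omega)]
  have h4 : ∀ j, (G fun i => if (if i < 2*0 then i else i+2) = 2*0+2+j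
            then br (cons2 X s (2*0)) (cons2 X s (2*0+1)) (cons2 X s (2*0+2+j))
            else α (cons2 X s (if i < 2*0 then i else i+2)))
      = G (fun i => if i = j then br X.1 X.2 (s i) else α (s i)) := by
    intro j
    congr 1
    funext i
    have e : 2*0+2+j = j+2 := by ring
    have a : (if i < 2*0 then i else i+2) = i + 2 := if_neg (by omega)
    rw [e, a]
    by_cases h : i = j
    · subst h; rw [if_pos rfl, if_pos rfl]; rfl
    · rw [if_neg h, if_neg (by omega)]; rfl
  have h5 : (F fun i => cons2 X s (if i < 2*0 then i else i+2)) = F s := by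
    congr 1
  simp only [h1, h2, h3, h4, h5]
  have s1 : ∀ k, (-1 : K)^(k+1+(n+1)) = (-1)^(k+n) := by intro k; ring
  have s2 : ∀ k, (-1 : K)^(n+1+(k+1)+1) = (-1)^(n+k+1) := by intro k; ring
  have s3 : (-1 : K)^(n+1+0+1) = - (-1)^(n+1) := by ring
  have s4 : ∀ k, n + 1 - (k+1) = n - k := by intro k; omega
  simp only [s1, s2, s3, s4, Nat.sub_zero, neg_smul, Finset.sum_neg_distrib, ← Finset.smul_sum,
    smul_sub, Nat.zero_add]
  change (θ (β (s (2*n+1)))) (β (s (2*n+2))) (F (cons2 X s)) -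
    (θ (β (s (2*n)))) (β (s (2*n+2))) (F (cons2 X (fun i => if i < 2*n then s i else s (2*n+1)))) +
    (∑ k ∈ Finset.range (n+1), ((-1 : K))^(k+n) •
        Dop θ (am β (s (2*k), s (2*k+1))) (F (cons2 X fun i => s (if i < 2*k then i else i+2)))
      + (-1 : K)^(n+1) • Dop θ (am β X) (F s)) + _ = _
  abel

lemma EE_eq (β : T →ₗ[K] T) (n : ℕ) : ∀ (l : List (T × T)) (_ : l.length = n + 1)
    (F G : (ℕ → T) → V) (_ : Dep n F) (_ : Dep n G) (z : T),
    EE br α θ β n F G (flat l z) = (-1 : K)^n • d br α θ β l (hat n F) (hat n G) z := by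
  induction n with
  | zero =>
    intro l hl F G hF hG z
    obtain ⟨X, rfl⟩ := List.length_eq_one_iff.mp hl
    have f0 : ∀ s t : ℕ → T, s 0 = t 0 → F s = F t := by
      intro s t h; apply hF; intro i hi
      have : i = 0 := by omega
      subst this; exact h
    have g0 : ∀ s t : ℕ → T, s 0 = t 0 → G s = G t := by
      intro s t h; apply hG; intro i hi
      have : i = 0 := by omega
      subst this; exact h
    simp only [EE, d, L, tp, S, hat, List.length_nil, if_true, flat, Nat.mul_zero, Nat.zero_add,
      Finset.sum_range_one, Nat.sub_zero, pow_zero, one_smul, Nat.add_zero, pow_one, neg_smul,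
      Nat.not_lt_zero, if_false, sub_zero]
    rw [f0 (cons2 X fun _ => z) (fun _ => X.1) rfl,
      g0 (fun i => if i + 2 = 2 then br (cons2 X (fun _ => z) 0) (cons2 X (fun _ => z) 1)
        (cons2 X (fun _ => z) 2) else α (cons2 X (fun _ => z) (i + 2)))
        (fun _ => br X.1 X.2 z) rfl]
    change (θ (β X.2)) (β z) _ - (θ (β X.1)) (β z) (F fun _ => X.2)
      + Dop θ (am β X) (F fun _ => z) + _ = _
    abel
  | succ n ih =>
    intro l hl F G hF hG z
    match l, hl with
    | X :: Y :: l, hl =>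
      have hl' : (Y :: l).length = n + 1 := by simpa using hl
      have hd : d br α θ β (X :: Y :: l) (hat (n+1) F) (hat (n+1) G) z
        = L α (br X.1 X.2) (Dop θ (am β X)) (hat (n+1) F) (hat (n+1) G) (Y :: l) z
          + tp θ β X (hat (n+1) F) (Y :: l) z
          - d br α θ β (Y :: l) (cns X (hat (n+1) F)) (cns (am α X) (hat (n+1) G)) z := rfl
      rw [flat, EE_succ, ih _ hl' _ _ (hF.cons _) (hG.cons _), hd, L, hat_cns, hat_cns,
        S_hat α _ _ (n+1) hl' G hG]
      simp only [hat, hl', if_true, tp, pow_succ, mul_neg, mul_one, neg_smul, smul_sub, smul_add,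
        smul_zero]
      abel

lemma d_len (β : T →ₗ[K] T) (l : List (T × T)) : ∀ (f g : List (T × T) → T → V)
    (_ : ∀ l' : List (T × T), l'.length + 1 = l.length → f l' = 0 ∧ g l' = 0) (z : T),
    d br α θ β l f g z = 0 := by
  have hS : ∀ (φ : T →ₗ[K] T) (l : List (T × T)) (g : List (T × T) → T → V)
      (_ : ∀ l' : List (T × T), l'.length = l.length → g l' = 0) (z : T), S α φ l g z = 0 := by
    intro φ l
    induction l with
    | nil => intro g hg z; simp [S, hg]
    | cons X l ih =>
      intro g hg z
      rw [S, ih (cns (am α X) g) (fun l' h => hg (am α X :: l') (by simp [h]))]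
      simp [pb, cns, hg]
  induction l with
  | nil => intros; rfl
  | cons X l ih =>
    intro f g hfg z
    rw [d, ih (cns X f) (cns (am α X) g) (fun l' h => ⟨(hfg (X :: l') (by simp [h])).1,
      (hfg (am α X :: l') (by simp [h])).2⟩), L, hS _ _ _ (fun l' h => (hfg l' (by simp [h])).2),
      (hfg l rfl).1]
    cases l with
    | nil => simp [tp, (hfg [] rfl).1]
    | cons Y l => simp [tp]

lemma exists_flat (n : ℕ) : ∀ X : ℕ → T, ∃ (l : List (T × T)) (z : T), l.length = n ∧
    ∀ i < 2*n+1, flat l z i = X i := by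
  induction n with
  | zero =>
    intro X
    refine ⟨[], X 0, rfl, fun i hi => ?_⟩
    have : i = 0 := by omega
    subst this; rfl
  | succ n ih =>
    intro X
    obtain ⟨l, z, hl, h⟩ := ih (fun i => X (i+2))
    refine ⟨(X 0, X 1) :: l, z, by simp [hl], fun i hi => ?_⟩
    match i with
    | 0 => rfl
    | 1 => rfl
    | i + 2 => exact h i (by omega)

/-- A cochain as a function of sequences. -/
def til (m : ℕ) (f : (Fin (2*m+1) → T) → V) : (ℕ → T) → V := fun s => f fun i => s i.val

lemma til_dep (m : ℕ) (f : (Fin (2*m+1) → T) → V) : Dep m (til m f) := by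
  intro s t h
  unfold til
  congr 1
  funext i
  exact h _ i.isLt

lemma cob_eq (m : ℕ) (f : (Fin (2*m+1) → T) → V) (s : ℕ → T) :
    homLtsCoboundary K (fun a b c => br a b c) (⇑α) (fun a b v => θ a b v) m f
      (fun i => s i.val) = EE br α θ (α ^ m) m (til m f) (til m f) s := by
  have hX : ∀ p < 2*m+3, (if h : p + 1 - 1 < 2*m+3 then s (p+1-1) else 0) = s p := by
    intro p hp
    simp [hp]
  have hY : ∀ p < 2*m+3, (if h : p < 2*m+3 then s p else 0) = s p := by
    intro p hp
    simp [hp]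
  have hI : Finset.Icc 1 (m+1) = (Finset.range (m+1)).image (· + 1) := by
    ext k; simp only [Finset.mem_Icc, Finset.mem_image, Finset.mem_range]
    constructor
    · rintro ⟨h1, h2⟩; exact ⟨k-1, by omega, by omega⟩
    · rintro ⟨a, h1, rfl⟩; omega
  have hsum : ∀ h : ℕ → V, ∑ k ∈ Finset.Icc 1 (m+1), h k
      = ∑ k ∈ Finset.range (m+1), h (k+1) := by
    intro h
    rw [hI, Finset.sum_image]
    intro a _ b _ hab
    simpa using hab
  have hsum2 : ∀ (k : ℕ) (h : ℕ → V), k < m + 1 →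
      ∑ j ∈ Finset.Icc (2*(k+1)+1) (2*(m+1)+1), h j
      = ∑ j ∈ Finset.range (2*(m-k)+1), h (2*k+2+j+1) := by
    intro k h hk
    have : Finset.Icc (2*(k+1)+1) (2*(m+1)+1)
        = (Finset.range (2*(m-k)+1)).image (fun j => 2*k+2+j+1) := by
      ext j; simp only [Finset.mem_Icc, Finset.mem_image, Finset.mem_range]
      constructor
      · rintro ⟨h1, h2⟩; exact ⟨j-(2*k+3), by omega, by omega⟩
      · rintro ⟨a, h1, rfl⟩; omega
    rw [this, Finset.sum_image]
    intro a _ b _ hab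
    simp only at hab
    omega
  simp only [homLtsCoboundary, hsum]
  unfold EE til
  have e1 : ∀ k, 2*(k+1) = 2*k+1+1 := by intro k; ring
  have e2 : ∀ k, 2*(k+1)-1 = 2*k+1 := by intro k; omega
  have e3 : ∀ k, 2*(k+1)-2 = 2*k := by intro k; omega
  congr 1
  · congr 1
    · congr 1
      · rw [e1, hX _ (by omega), hX _ (by omega), Nat.add_sub_cancel,
          Module.End.pow_apply, Module.End.pow_apply]
        congr 2
        funext i
        exact hX _ (by omega)
      · rw [e2, e3, e1, hX (2*m) (by omega), hX (2*m+2) (by omega), hY (2*m+1) (by omega),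
          Nat.add_sub_cancel,
          Module.End.pow_apply, Module.End.pow_apply]
        congr 2
        funext i
        simp only [Nat.succ_le_iff]
        rw [hX _ (by omega)]
    · apply Finset.sum_congr rfl
      intro k hk
      have hk' := Finset.mem_range.mp hk
      rw [e2, e3, hX (2*k) (by omega), hY (2*k+1) (by omega), Nat.add_sub_cancel]
      have s1 : (-1 : K)^(k+1+(m+1)) = (-1)^(k+m) := by ring
      rw [s1]
      have : (fun i : Fin (2*m+1) => if h : (if i.val + 1 ≤ 2*k then i.val+1 else i.val+3) - 1
          < 2*m+3 then s ((if i.val + 1 ≤ 2*k then i.val+1 else i.val+3) - 1) else 0)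
          = fun i : Fin (2*m+1) => s (if i.val < 2*k then i.val else i.val+2) := by
        funext i
        by_cases h : i.val < 2*k
        · simp only [Nat.succ_le_iff, h, if_true]; exact hX _ (by omega)
        · simp only [Nat.succ_le_iff, h, if_false]; exact hX (i.val+2) (by omega)
      rw [this]
      simp only [Dop, am, LinearMap.sub_apply, Module.End.pow_apply]
  · apply Finset.sum_congr rfl
    intro k hk
    have hk' := Finset.mem_range.mp hk
    rw [hsum2 k _ hk']
    apply Finset.sum_congr rfl
    intro j hj
    have hj' := Finset.mem_range.mp hj
    have s2 : (-1 : K)^(m+1+(k+1)+1) = (-1)^(m+k+1) := by ring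
    rw [e2, e3, hX (2*k) (by omega), hY (2*k+1) (by omega), hX (2*k+2+j) (by omega), s2]
    congr 2
    funext i
    by_cases h : i.val < 2*k
    · simp only [Nat.succ_le_iff, h, if_true]
      rw [hX _ (by omega)]
      exact if_congr (by omega) rfl rfl
    · simp only [Nat.succ_le_iff, h, if_false]
      rw [hX (i.val+2) (by omega)]
      exact if_congr (by omega) rfl rfl

lemma flat_fst (l₁ l₂ : List (T × T)) (a b z : T) :
    flat (l₁ ++ (a, b) :: l₂) z
      = Function.update (flat (l₁ ++ (0, b) :: l₂) z) (2*l₁.length) a := by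
  induction l₁ with
  | nil =>
    funext i
    match i with
    | 0 => simp [flat, cons2]
    | 1 => simp [flat, cons2]
    | i + 2 => simp [flat, cons2]
  | cons X l ih =>
    funext i
    match i with
    | 0 => rw [Function.update_of_ne (by simp)]; rfl
    | 1 => rw [Function.update_of_ne (by simp; omega)]; rfl
    | i + 2 =>
      have := congrFun ih i
      simp only [List.cons_append, flat, cons2, List.length_cons, this, Function.update_apply]
      have : i + 2 = 2 * (l.length + 1) ↔ i = 2 * l.length := by omega
      simp only [this]

lemma flat_snd (l₁ l₂ : List (T × T)) (a b z : T) :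
    flat (l₁ ++ (a, b) :: l₂) z
      = Function.update (flat (l₁ ++ (a, 0) :: l₂) z) (2*l₁.length+1) b := by
  induction l₁ with
  | nil =>
    funext i
    match i with
    | 0 => simp [flat, cons2]
    | 1 => simp [flat, cons2]
    | i + 2 => simp [flat, cons2]
  | cons X l ih =>
    funext i
    match i with
    | 0 => rw [Function.update_of_ne (by simp)]; rfl
    | 1 => rw [Function.update_of_ne (by simp)]; rfl
    | i + 2 =>
      have := congrFun ih i
      simp only [List.cons_append, flat, cons2, List.length_cons, this, Function.update_apply]
      have : i + 2 = 2 * (l.length + 1) + 1 ↔ i = 2 * l.length + 1 := by omega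
      simp only [this]

lemma flat_last (l : List (T × T)) (z : T) (i : ℕ) (hi : i < 2*l.length+1) :
    flat l z i = Function.update (flat l 0) (2*l.length) z i := by
  induction l generalizing i with
  | nil =>
    have : i = 0 := by simpa using hi
    subst this; simp [flat]
  | cons X l ih =>
    match i with
    | 0 => rw [Function.update_of_ne (by simp)]; rfl
    | 1 => rw [Function.update_of_ne (by simp; omega)]; rfl
    | i + 2 =>
      have := ih i (by simp at hi; omega)
      simp only [flat, cons2, List.length_cons, this, Function.update_apply]
      have : i + 2 = 2 * (l.length + 1) ↔ i = 2 * l.length := by omega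
      simp only [this]

lemma til_update (m : ℕ) (f : (Fin (2*m+1) → T) → V)
    (hf : ∀ (x : Fin (2*m+1) → T) (i : Fin (2*m+1)) (c : K) (u v : T),
      f (Function.update x i (c • u + v)) =
        c • f (Function.update x i u) + f (Function.update x i v))
    (s : ℕ → T) (i : ℕ) (hi : i < 2*m+1) (u v : T) :
    til m f (Function.update s i (u + v))
      = til m f (Function.update s i u) + til m f (Function.update s i v) := by
  have e : ∀ w, (fun j : Fin (2*m+1) => Function.update s i w j.val)
      = Function.update (fun j : Fin (2*m+1) => s j.val) ⟨i, hi⟩ w := by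
    intro w
    funext j
    simp only [Function.update_apply, Fin.ext_iff]
  have := hf (fun j => s j.val) ⟨i, hi⟩ 1 u v
  simp only [one_smul] at this
  simp only [til, e, this]

lemma hat_Ad (m : ℕ) (f : (Fin (2*m+1) → T) → V)
    (hf : ∀ (x : Fin (2*m+1) → T) (i : Fin (2*m+1)) (c : K) (u v : T),
      f (Function.update x i (c • u + v)) =
        c • f (Function.update x i u) + f (Function.update x i v)) :
    Ad (hat m (til m f)) := by
  refine ⟨fun l u v => ?_, fun l₁ l₂ a a' b z => ?_, fun l₁ l₂ a b b' z => ?_⟩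
  · by_cases h : l.length = m
    · have e : ∀ z, til m f (flat l z) = til m f (Function.update (flat l 0) (2*l.length) z) :=
        fun z => til_dep m f _ _ (fun i hi => flat_last l z i (by omega))
      simp only [hat, h, if_true]
      rw [e, e u, e v, til_update m f hf _ _ (by omega)]
    · simp [hat, h]
  · simp only [hat, List.length_append, List.length_cons]
    by_cases h : l₁.length + (l₂.length + 1) = m
    · simp only [h, if_true]
      rw [flat_fst, flat_fst l₁ l₂ a, flat_fst l₁ l₂ a', til_update m f hf _ _ (by omega)]
    · simp [h]
  · simp only [hat, List.length_append, List.length_cons]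
    by_cases h : l₁.length + (l₂.length + 1) = m
    · simp only [h, if_true]
      rw [flat_snd, flat_snd l₁ l₂ a b, flat_snd l₁ l₂ a b', til_update m f hf _ _ (by omega)]
    · simp [h]

end alg
end HomLtsAux

/-- Let `(T, br, α)` be a multiplicative Hom Lie triple system over a
field `K` and `(V, θ, A)` a representation of `T` with respect to `A`.  Then the
coboundary operators of the Hom Lie triple system cochain complex satisfy
`δ^{2n+1} ∘ δ^{2n−1} = 0` for every `n ≥ 1` (below `n = m + 1`); in particular the
spaces `C^{2n+1}_{α,A}(T;V)` with these coboundaries form a cochain complex. -/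
theorem stmt0 {K T V : Type*} [Field K]
    [AddCommGroup T] [Module K T] [AddCommGroup V] [Module K V]
    -- `T` is a multiplicative Hom Lie triple system
    (br : T →ₗ[K] T →ₗ[K] T →ₗ[K] T) (α : T →ₗ[K] T)
    (hT1 : ∀ a c, br a a c = 0)
    (hT2 : ∀ a b c, br a b c + br b c a + br c a b = 0)
    (hT3 : ∀ a b c d e, br (α a) (α b) (br c d e) =
      br (br a b c) (α d) (α e) + br (α c) (br a b d) (α e) +
        br (α c) (α d) (br a b e))
    (hTmul : ∀ a b c, α (br a b c) = br (α a) (α b) (α c))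
    -- `(V, θ, A)` is a representation of `T` with respect to `A`
    (A : V →ₗ[K] V) (θ : T →ₗ[K] T →ₗ[K] V →ₗ[K] V)
    (hR1 : ∀ a b v, θ (α a) (α b) (A v) = A (θ a b v))
    (hR2 : ∀ a b c d v,
      θ (α c) (α d) (θ a b v) - θ (α b) (α d) (θ a c v) -
          θ (α a) (br b c d) (A v) +
        (θ (α c) (α b) (θ a d v) - θ (α b) (α c) (θ a d v)) = 0)
    (hR3 : ∀ a b c d v,
      θ (α c) (α d) (θ b a v - θ a b v) -
          (θ (α b) (α a) (θ c d v) - θ (α a) (α b) (θ c d v)) +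
        θ (br a b c) (α d) (A v) + θ (α c) (br a b d) (A v) = 0) :
    ∀ (m : ℕ) (f : (Fin (2*m+1) → T) → V),
      IsHomLtsCochain K (⇑α) (⇑A) m f →
      ∀ x, homLtsCoboundary K (fun a b c => br a b c) (⇑α)
          (fun a b v => θ a b v) (m+1)
          (homLtsCoboundary K (fun a b c => br a b c) (⇑α)
            (fun a b v => θ a b v) m f) x = 0 := by
  intro m f hf x
  obtain ⟨hlin, hA, -, -⟩ := hf
  have hβα : ∀ z, (α ^ m) (α z) = α ((α ^ m) z) := by
    intro z
    rw [Module.End.pow_apply, Module.End.pow_apply]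
    exact ((Function.Commute.refl α).iterate_left m) z
  have hβ : ∀ a b c, (α ^ m) (br a b c) = br ((α ^ m) a) ((α ^ m) b) ((α ^ m) c) := by
    clear hA hlin x f
    intro a b c
    induction m with
    | zero => rfl
    | succ m ih =>
      have e : ∀ z, (α ^ (m+1)) z = α ((α ^ m) z) := fun z => by rw [pow_succ']; rfl
      simp only [e, ← hTmul]
      rw [ih]
      exact fun z => by
        rw [Module.End.pow_apply, Module.End.pow_apply]
        exact ((Function.Commute.refl α).iterate_left m) z
  obtain ⟨l, z, hl, hx⟩ := HomLtsAux.exists_flat (m+2)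
    (fun p => if h : p < 2*(m+1)+3 then x ⟨p, h⟩ else 0)
  have hx' : x = fun i => HomLtsAux.flat l z i.val := by
    funext i
    rw [hx _ (by omega)]
    simp
  have hpow : α ^ (m+1) = (α ^ m) ∘ₗ α := pow_succ α m
  rw [hx', HomLtsAux.cob_eq, HomLtsAux.EE_eq br α θ _ (m+1) l hl _ _
    (HomLtsAux.til_dep _ _) (HomLtsAux.til_dep _ _), hpow]
  set fh := HomLtsAux.hat m (HomLtsAux.til m f) with hfh
  have key : HomLtsAux.hat (m+1) (HomLtsAux.til (m+1) (homLtsCoboundary K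
      (fun a b c => br a b c) (⇑α) (fun a b v => θ a b v) m f))
      = (-1 : K)^m • HomLtsAux.dC br α θ (α ^ m) fh fh := by
    funext l z
    by_cases h : l.length = m + 1
    · simp only [HomLtsAux.hat, h, if_true, Pi.smul_apply, HomLtsAux.dC]
      rw [hfh, ← HomLtsAux.EE_eq br α θ _ m l h _ _ (HomLtsAux.til_dep _ _)
        (HomLtsAux.til_dep _ _), ← HomLtsAux.cob_eq]
      rfl
    · simp only [HomLtsAux.hat, h, if_false, Pi.smul_apply, HomLtsAux.dC]
      rw [HomLtsAux.d_len, smul_zero]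
      intro l' hl'
      have : l'.length ≠ m := by omega
      constructor <;> (funext z; simp [hfh, HomLtsAux.hat, this])
  rw [key, HomLtsAux.d_smul, HomLtsAux.d_d br α θ hT3 hTmul A hR2 hR3 (α ^ m) hβα hβ l fh fh fh
    (HomLtsAux.hat_Ad m f hlin), smul_zero, smul_zero]
  intro l z
  simp only [hfh, HomLtsAux.hat, List.length_map]
  by_cases h : l.length = m
  · simp only [h, if_true, HomLtsAux.flat_map, HomLtsAux.til, hA]
  · simp [h]
end

section
/- Let (T,[·,·,·],α) be a G-Hom Lts such that H⁵_{G(α)}(T) = 0. Then every 3-cocycle μ₁ in C³_{G(α)}(T) is the infinitesimal of some equivariant formal one-parameter deformation of T: there exist equivariant 3-cochains μ_i ∈ C³_{G(α)}(T) for i ≥ 2 such that μ_t = μ₀ + μ₁ t + Σ_{i≥2} μ_i t^i (with μ₀ = [·,·,·]) is an equivariant formal one-parameter deformation of T. -/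
theorem tri_neg {K T : Type*} [Field K] [AddCommGroup T] [Module K T]
    (m : T →ₗ[K] T →ₗ[K] T →ₗ[K] T) (h : ∀ a c, m a a c = 0) (a b c : T) :
    m a b c = - m b a c := by
  have := h (a + b) c
  simp only [map_add, LinearMap.add_apply, h, zero_add, add_zero] at this
  rw [eq_neg_iff_add_eq_zero, add_comm]; exact this

/-- bundled 5-linear map from a function. -/
def mk5 {K T : Type*} [Field K] [AddCommGroup T] [Module K T]
    (f : T → T → T → T → T → T)
    (a1 : ∀ x y b c d e, f (x + y) b c d e = f x b c d e + f y b c d e)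
    (s1 : ∀ (k : K) x b c d e, f (k • x) b c d e = k • f x b c d e)
    (a2 : ∀ a x y c d e, f a (x + y) c d e = f a x c d e + f a y c d e)
    (s2 : ∀ (k : K) a x c d e, f a (k • x) c d e = k • f a x c d e)
    (a3 : ∀ a b x y d e, f a b (x + y) d e = f a b x d e + f a b y d e)
    (s3 : ∀ (k : K) a b x d e, f a b (k • x) d e = k • f a b x d e)
    (a4 : ∀ a b c x y e, f a b c (x + y) e = f a b c x e + f a b c y e)
    (s4 : ∀ (k : K) a b c x e, f a b c (k • x) e = k • f a b c x e)
    (a5 : ∀ a b c d x y, f a b c d (x + y) = f a b c d x + f a b c d y)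
    (s5 : ∀ (k : K) a b c d x, f a b c d (k • x) = k • f a b c d x) :
    T →ₗ[K] T →ₗ[K] T →ₗ[K] T →ₗ[K] T →ₗ[K] T where
  toFun a :=
    { toFun := fun b =>
        { toFun := fun c => LinearMap.mk₂ K (f a b c) (a4 a b c) (fun k x e => s4 k a b c x e)
            (a5 a b c) (fun k d x => s5 k a b c d x)
          map_add' := fun x y => by ext; simp [a3]
          map_smul' := fun k x => by ext; simp [s3] }
      map_add' := fun x y => by ext; simp [a2]
      map_smul' := fun k x => by ext; simp [s2] }
  map_add' := fun x y => by ext; simp [a1]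
  map_smul' := fun k x => by ext; simp [s1]

/-- The defect of the Hom-Nambu identity, polarized. -/
def J5 {K T : Type*} [Field K] [AddCommGroup T] [Module K T] (α : T →ₗ[K] T)
    (m n : T →ₗ[K] T →ₗ[K] T →ₗ[K] T) : T →ₗ[K] T →ₗ[K] T →ₗ[K] T →ₗ[K] T →ₗ[K] T :=
  mk5 (fun a b c d e => m (α a) (α b) (n c d e) -
      (m (n a b c) (α d) (α e) + m (α c) (n a b d) (α e) + m (α c) (α d) (n a b e)))
    (by intros; simp only [map_add, LinearMap.add_apply]; abel)
    (by intros; simp only [map_smul, LinearMap.smul_apply, smul_add, smul_sub])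
    (by intros; simp only [map_add, LinearMap.add_apply]; abel)
    (by intros; simp only [map_smul, LinearMap.smul_apply, smul_add, smul_sub])
    (by intros; simp only [map_add, LinearMap.add_apply]; abel)
    (by intros; simp only [map_smul, LinearMap.smul_apply, smul_add, smul_sub])
    (by intros; simp only [map_add, LinearMap.add_apply]; abel)
    (by intros; simp only [map_smul, LinearMap.smul_apply, smul_add, smul_sub])
    (by intros; simp only [map_add, LinearMap.add_apply]; abel)
    (by intros; simp only [map_smul, LinearMap.smul_apply, smul_add, smul_sub])

theorem J5_apply {K T : Type*} [Field K] [AddCommGroup T] [Module K T] (α : T →ₗ[K] T)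
    (m n : T →ₗ[K] T →ₗ[K] T →ₗ[K] T) (a b c d e : T) :
    J5 α m n a b c d e = m (α a) (α b) (n c d e) -
      (m (n a b c) (α d) (α e) + m (α c) (n a b d) (α e) + m (α c) (α d) (n a b e)) := rfl

/-- Outer part of the coboundary. -/
def dA {K T : Type*} [Field K] [AddCommGroup T] [Module K T] (α : T →ₗ[K] T)
    (m : T →ₗ[K] T →ₗ[K] T →ₗ[K] T) (F : T →ₗ[K] T →ₗ[K] T →ₗ[K] T →ₗ[K] T →ₗ[K] T)
    (x₁ x₂ x₃ x₄ x₅ x₆ x₇ : T) : T :=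
  m (F x₁ x₂ x₃ x₄ x₅) (α (α x₆)) (α (α x₇)) -
              m (F x₁ x₂ x₃ x₄ x₆) (α (α x₅)) (α (α x₇)) +
            m (α (α x₁)) (α (α x₂)) (F x₃ x₄ x₅ x₆ x₇) -
            m (α (α x₃)) (α (α x₄)) (F x₁ x₂ x₅ x₆ x₇) +
            m (α (α x₅)) (α (α x₆)) (F x₁ x₂ x₃ x₄ x₇)

/-- Inner part of the coboundary (negated). -/
def dB {K T : Type*} [Field K] [AddCommGroup T] [Module K T] (α : T →ₗ[K] T)
    (F : T →ₗ[K] T →ₗ[K] T →ₗ[K] T →ₗ[K] T →ₗ[K] T) (m : T →ₗ[K] T →ₗ[K] T →ₗ[K] T)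
    (x₁ x₂ x₃ x₄ x₅ x₆ x₇ : T) : T :=
            F (m x₁ x₂ x₃) (α x₄) (α x₅) (α x₆) (α x₇) +
            F (α x₃) (m x₁ x₂ x₄) (α x₅) (α x₆) (α x₇) +
            F (α x₃) (α x₄) (m x₁ x₂ x₅) (α x₆) (α x₇) +
            F (α x₃) (α x₄) (α x₅) (m x₁ x₂ x₆) (α x₇) +
            F (α x₃) (α x₄) (α x₅) (α x₆) (m x₁ x₂ x₇) -
            F (α x₁) (α x₂) (m x₃ x₄ x₅) (α x₆) (α x₇) -
            F (α x₁) (α x₂) (α x₅) (m x₃ x₄ x₆) (α x₇) -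
            F (α x₁) (α x₂) (α x₅) (α x₆) (m x₃ x₄ x₇) +
          F (α x₁) (α x₂) (α x₃) (α x₄) (m x₅ x₆ x₇)

/-- The terms with two parallel inner brackets. -/
def parP {K T : Type*} [Field K] [AddCommGroup T] [Module K T] (α : T →ₗ[K] T)
    (m n p : T →ₗ[K] T →ₗ[K] T →ₗ[K] T)
    (x₁ x₂ x₃ x₄ x₅ x₆ x₇ : T) : T :=
  m (n (α x₁) (α x₂) (α x₃)) (α (α x₄)) (p (α x₅) (α x₆) (α x₇)) +
  m (α (α x₃)) (n (α x₁) (α x₂) (α x₄)) (p (α x₅) (α x₆) (α x₇)) -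
  (m (n (α x₁) (α x₂) (α x₅)) (p (α x₃) (α x₄) (α x₆)) (α (α x₇)) +
   m (p (α x₃) (α x₄) (α x₅)) (n (α x₁) (α x₂) (α x₆)) (α (α x₇)) +
   m (n (α x₁) (α x₂) (α x₅)) (α (α x₆)) (p (α x₃) (α x₄) (α x₇)) +
   m (p (α x₃) (α x₄) (α x₅)) (α (α x₆)) (n (α x₁) (α x₂) (α x₇)) +
   m (α (α x₅)) (n (α x₁) (α x₂) (α x₆)) (p (α x₃) (α x₄) (α x₇)) +
   m (α (α x₅)) (p (α x₃) (α x₄) (α x₆)) (n (α x₁) (α x₂) (α x₇)))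

theorem bianchi {K T : Type*} [Field K] [AddCommGroup T] [Module K T] (α : T →ₗ[K] T)
    (m n p : T →ₗ[K] T →ₗ[K] T →ₗ[K] T)
    (hm : ∀ a c, m a a c = 0)
    (an : ∀ a b c, n (α a) (α b) (α c) = α (n a b c))
    (ap : ∀ a b c, p (α a) (α b) (α c) = α (p a b c))
    (x₁ x₂ x₃ x₄ x₅ x₆ x₇ : T) :
    dA α m (J5 α n p) x₁ x₂ x₃ x₄ x₅ x₆ x₇ - dB α (J5 α m n) p x₁ x₂ x₃ x₄ x₅ x₆ x₇ =
    parP α m n p x₁ x₂ x₃ x₄ x₅ x₆ x₇ - parP α m p n x₁ x₂ x₃ x₄ x₅ x₆ x₇ := by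
  unfold dA dB parP
  rw [tri_neg m hm (J5 α n p x₁ x₂ x₃ x₄ x₆)]
  simp only [J5_apply, map_add, map_sub, LinearMap.add_apply, LinearMap.sub_apply, an, ap]
  abel

theorem sum_assoc {M : Type*} [AddCommMonoid M] (r : ℕ) (f : ℕ → ℕ → ℕ → M) :
    ∑ x ∈ Finset.HasAntidiagonal.antidiagonal r,
      ∑ y ∈ Finset.HasAntidiagonal.antidiagonal x.1, f y.1 y.2 x.2 =
    ∑ x ∈ Finset.HasAntidiagonal.antidiagonal r,
      ∑ y ∈ Finset.HasAntidiagonal.antidiagonal x.2, f x.1 y.1 y.2 := by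
  rw [Finset.sum_sigma', Finset.sum_sigma']
  refine Finset.sum_nbij' (fun z => ⟨(z.2.1, z.2.2 + z.1.2), (z.2.2, z.1.2)⟩)
    (fun z => ⟨(z.1.1 + z.2.1, z.2.2), (z.1.1, z.2.1)⟩) ?_ ?_ ?_ ?_ ?_
  · rintro ⟨⟨a, b⟩, ⟨c, d⟩⟩ h
    simp at h ⊢; omega
  · rintro ⟨⟨a, b⟩, ⟨c, d⟩⟩ h
    simp at h ⊢; omega
  · rintro ⟨⟨a, b⟩, ⟨c, d⟩⟩ h
    simp at h ⊢; omega
  · rintro ⟨⟨a, b⟩, ⟨c, d⟩⟩ h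
    simp at h ⊢; omega
  · rintro ⟨⟨a, b⟩, ⟨c, d⟩⟩ h
    rfl

theorem total {K T : Type*} [Field K] [AddCommGroup T] [Module K T] (α : T →ₗ[K] T)
    (g : ℕ → T →ₗ[K] T →ₗ[K] T →ₗ[K] T)
    (hm : ∀ i a c, g i a a c = 0)
    (an : ∀ i a b c, g i (α a) (α b) (α c) = α (g i a b c)) (r : ℕ)
    (h0 : ∀ s < r, ∑ y ∈ Finset.HasAntidiagonal.antidiagonal s, J5 α (g y.1) (g y.2) = 0)
    (x₁ x₂ x₃ x₄ x₅ x₆ x₇ : T) :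
    dA α (g 0) (∑ y ∈ Finset.HasAntidiagonal.antidiagonal r, J5 α (g y.1) (g y.2)) x₁ x₂ x₃ x₄ x₅ x₆ x₇ -
    dB α (∑ y ∈ Finset.HasAntidiagonal.antidiagonal r, J5 α (g y.1) (g y.2)) (g 0) x₁ x₂ x₃ x₄ x₅ x₆ x₇
      = 0 := by
  set J : ℕ → _ := fun s => ∑ y ∈ Finset.HasAntidiagonal.antidiagonal s, J5 α (g y.1) (g y.2) with hJ
  have eA : ∀ i s, dA α (g i) (J s) x₁ x₂ x₃ x₄ x₅ x₆ x₇ =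
      ∑ y ∈ Finset.HasAntidiagonal.antidiagonal s, dA α (g i) (J5 α (g y.1) (g y.2)) x₁ x₂ x₃ x₄ x₅ x₆ x₇ := by
    intro i s
    simp only [dA, hJ, LinearMap.sum_apply, map_sum, Finset.sum_add_distrib,
      Finset.sum_sub_distrib]
  have eB : ∀ i s, dB α (J s) (g i) x₁ x₂ x₃ x₄ x₅ x₆ x₇ =
      ∑ y ∈ Finset.HasAntidiagonal.antidiagonal s, dB α (J5 α (g y.1) (g y.2)) (g i) x₁ x₂ x₃ x₄ x₅ x₆ x₇ := by
    intro i s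
    simp only [dB, hJ, LinearMap.sum_apply, Finset.sum_add_distrib,
      Finset.sum_sub_distrib]
  have A1 : ∑ x ∈ Finset.HasAntidiagonal.antidiagonal r, dA α (g x.1) (J x.2) x₁ x₂ x₃ x₄ x₅ x₆ x₇ =
      dA α (g 0) (J r) x₁ x₂ x₃ x₄ x₅ x₆ x₇ := by
    rw [Finset.sum_eq_single (0, r)]
    · rintro ⟨i, j⟩ hx hne
      have hij : i + j = r := by simpa using hx
      have : j < r := by
        rcases Nat.eq_zero_or_pos i with h | h
        · exact absurd (by subst h; simp at hij; simp [hij]) hne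
        · omega
      have e : J j = 0 := h0 j this
      simp [dA, e]
    · intro h; simp at h
  have B1 : ∑ x ∈ Finset.HasAntidiagonal.antidiagonal r, dB α (J x.1) (g x.2) x₁ x₂ x₃ x₄ x₅ x₆ x₇ =
      dB α (J r) (g 0) x₁ x₂ x₃ x₄ x₅ x₆ x₇ := by
    rw [Finset.sum_eq_single (r, 0)]
    · rintro ⟨i, j⟩ hx hne
      have hij : i + j = r := by simpa using hx
      have : i < r := by
        rcases Nat.eq_zero_or_pos j with h | h
        · exact absurd (by subst h; simp at hij; simp [hij]) hne
        · omega
      have e : J i = 0 := h0 i this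
      simp [dB, e]
    · intro h; simp at h
  change dA α (g 0) (J r) x₁ x₂ x₃ x₄ x₅ x₆ x₇ - dB α (J r) (g 0) x₁ x₂ x₃ x₄ x₅ x₆ x₇ = 0
  rw [← A1, ← B1]
  simp only [eA, eB]
  rw [sum_assoc r (fun i j k => dB α (J5 α (g i) (g j)) (g k) x₁ x₂ x₃ x₄ x₅ x₆ x₇),
    ← Finset.sum_sub_distrib]
  refine Finset.sum_eq_zero fun x _ => ?_
  rw [← Finset.sum_sub_distrib]
  simp only [bianchi α _ _ _ (hm _) (an _) (an _)]
  rw [Finset.sum_sub_distrib, sub_eq_zero]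
  exact Finset.Nat.sum_antidiagonal_swap
    (f := fun y : ℕ × ℕ => parP α (g x.1) (g y.2) (g y.1) x₁ x₂ x₃ x₄ x₅ x₆ x₇)

theorem exists_rec {X : Type*} (z : X) (step : ℕ → (ℕ → X) → X) :
    ∃ f : ℕ → X, ∀ n, f n = step n (fun i => if i < n then f i else z) := by
  refine ⟨fun n => Nat.strongRec (motive := fun _ => X)
    (fun n ih => step n (fun i => if h : i < n then ih i h else z)) n, ?_⟩
  intro n
  beta_reduce
  rw [Nat.strongRec_eq]
  simp only [dite_eq_ite]

theorem J5_zero_left {K T : Type*} [Field K] [AddCommGroup T] [Module K T] (α : T →ₗ[K] T)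
    (n : T →ₗ[K] T →ₗ[K] T →ₗ[K] T) : J5 α 0 n = 0 := by
  ext; simp [J5_apply]

theorem J5_zero_right {K T : Type*} [Field K] [AddCommGroup T] [Module K T] (α : T →ₗ[K] T)
    (n : T →ₗ[K] T →ₗ[K] T →ₗ[K] T) : J5 α n 0 = 0 := by
  ext; simp [J5_apply]

/-- Invariant 3-cochains. -/
def IsC {K T : Type*} (G : Type*) [Field K] [AddCommGroup T] [Module K T]
    [Group G] [DistribMulAction G T] (α : T →ₗ[K] T)
    (ν : T →ₗ[K] T →ₗ[K] T →ₗ[K] T) : Prop :=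
  (∀ (g : G) (a b c : T), ν (g • a) (g • b) (g • c) = g • ν a b c) ∧
  (∀ a b c, ν (α a) (α b) (α c) = α (ν a b c)) ∧
  (∀ a b, ν a a b = 0) ∧
  (∀ a b c, ν a b c + ν b c a + ν c a b = 0)

section J5props
variable {K T G : Type*} [Field K] [AddCommGroup T] [Module K T]
    [Group G] [DistribMulAction G T] (α : T →ₗ[K] T)
    (m n : T →ₗ[K] T →ₗ[K] T →ₗ[K] T)

theorem J5_alpha (hm : IsC G α m) (hn : IsC G α n) (a b c d e : T) :
    α (J5 α m n a b c d e) = J5 α m n (α a) (α b) (α c) (α d) (α e) := by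
  simp only [J5_apply, map_add, map_sub, hn.2.1, ← hm.2.1]

theorem J5_act (hTα : ∀ (g : G) (a : T), α (g • a) = g • α a)
    (hm : IsC G α m) (hn : IsC G α n) (g : G) (a b c d e : T) :
    J5 α m n (g • a) (g • b) (g • c) (g • d) (g • e) = g • J5 α m n a b c d e := by
  simp only [J5_apply, hTα, hn.1, hm.1, smul_sub, smul_add]

theorem J5_alt (hm : IsC G α m) (hn : IsC G α n) (a b c e : T) :
    J5 α m n a b c c e = 0 := by
  rw [J5_apply, hn.2.2.1, hm.2.2.1, tri_neg m hm.2.2.1 (α c) (n a b c)]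
  simp

theorem J5_cyc (hm : IsC G α m) (hn : IsC G α n) (a b x y z : T) :
    J5 α m n a b x y z + J5 α m n a b y z x + J5 α m n a b z x y = 0 := by
  have e0 : m (α a) (α b) (n x y z) + m (α a) (α b) (n y z x) + m (α a) (α b) (n z x y) = 0 := by
    rw [← map_add, ← map_add, hn.2.2.2, map_zero]
  have e1 := hm.2.2.2 (n a b x) (α y) (α z)
  have e2 := hm.2.2.2 (n a b y) (α z) (α x)
  have e3 := hm.2.2.2 (n a b z) (α x) (α y)
  simp only [J5_apply]
  have key : ∀ p q u v : T, p = 0 → q = 0 → u = 0 → v = 0 → p - q - u - v = 0 := by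
    rintro _ _ _ _ rfl rfl rfl rfl
    simp
  rw [← key _ _ _ _ e0 e1 e2 e3]
  abel

end J5props


/-- Let `(T, brT, α)` be a `G`-Hom Lie triple system with
`H⁵_{G(α)}(T) = 0` (every `G`-invariant 5-cocycle with adjoint coefficients is the
coboundary `δ³` of a `G`-invariant 3-cochain).  Then every 3-cocycle `μ₁` in
`C³_{G(α)}(T)` is the infinitesimal of some equivariant formal one-parameter
deformation of `T`. -/
theorem stmt13 {K : Type*} [Field K] {T G : Type*}
    [AddCommGroup T] [Module K T]
    [Group G] [DistribMulAction G T] [SMulCommClass G K T]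
    -- `T` is a `G`-Hom Lie triple system
    (brT : T →ₗ[K] T →ₗ[K] T →ₗ[K] T) (α : T →ₗ[K] T)
    (hT1 : ∀ a c, brT a a c = 0)
    (hT2 : ∀ a b c, brT a b c + brT b c a + brT c a b = 0)
    (hT3 : ∀ a b c d e, brT (α a) (α b) (brT c d e) =
      brT (brT a b c) (α d) (α e) + brT (α c) (brT a b d) (α e) +
        brT (α c) (α d) (brT a b e))
    (hTmul : ∀ a b c, α (brT a b c) = brT (α a) (α b) (α c))
    (hTact : ∀ (g : G) (a b c : T), g • brT a b c = brT (g • a) (g • b) (g • c))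
    (hTα : ∀ (g : G) (a : T), α (g • a) = g • α a)
    -- `H⁵_{G(α)}(T) = 0`: every invariant 5-cocycle is a coboundary `δ³ ν`
    (hH5 : ∀ F : T →ₗ[K] T →ₗ[K] T →ₗ[K] T →ₗ[K] T →ₗ[K] T,
      (∀ x₁ x₂ x₃ x₄ x₅, α (F x₁ x₂ x₃ x₄ x₅) =
        F (α x₁) (α x₂) (α x₃) (α x₄) (α x₅)) →
      (∀ x₁ x₂ x y, F x₁ x₂ x x y = 0) →
      (∀ x₁ x₂ x y z,
        F x₁ x₂ x y z + F x₁ x₂ y z x + F x₁ x₂ z x y = 0) →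
      (∀ (g : G) (x₁ x₂ x₃ x₄ x₅ : T),
        F (g • x₁) (g • x₂) (g • x₃) (g • x₄) (g • x₅) = g • F x₁ x₂ x₃ x₄ x₅) →
      (∀ x₁ x₂ x₃ x₄ x₅ x₆ x₇ : T,
        brT (F x₁ x₂ x₃ x₄ x₅) (α (α x₆)) (α (α x₇)) -
              brT (F x₁ x₂ x₃ x₄ x₆) (α (α x₅)) (α (α x₇)) +
            brT (α (α x₁)) (α (α x₂)) (F x₃ x₄ x₅ x₆ x₇) -
            brT (α (α x₃)) (α (α x₄)) (F x₁ x₂ x₅ x₆ x₇) +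
            brT (α (α x₅)) (α (α x₆)) (F x₁ x₂ x₃ x₄ x₇) -
            F (brT x₁ x₂ x₃) (α x₄) (α x₅) (α x₆) (α x₇) -
            F (α x₃) (brT x₁ x₂ x₄) (α x₅) (α x₆) (α x₇) -
            F (α x₃) (α x₄) (brT x₁ x₂ x₅) (α x₆) (α x₇) -
            F (α x₃) (α x₄) (α x₅) (brT x₁ x₂ x₆) (α x₇) -
            F (α x₃) (α x₄) (α x₅) (α x₆) (brT x₁ x₂ x₇) +
            F (α x₁) (α x₂) (brT x₃ x₄ x₅) (α x₆) (α x₇) +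
            F (α x₁) (α x₂) (α x₅) (brT x₃ x₄ x₆) (α x₇) +
            F (α x₁) (α x₂) (α x₅) (α x₆) (brT x₃ x₄ x₇) -
          F (α x₁) (α x₂) (α x₃) (α x₄) (brT x₅ x₆ x₇) = 0) →
      ∃ ν : T →ₗ[K] T →ₗ[K] T →ₗ[K] T,
        (∀ (g : G) (a b c : T), ν (g • a) (g • b) (g • c) = g • ν a b c) ∧
        (∀ a b c, ν (α a) (α b) (α c) = α (ν a b c)) ∧
        (∀ a b, ν a a b = 0) ∧
        (∀ a b c, ν a b c + ν b c a + ν c a b = 0) ∧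
        (∀ x₁ x₂ x₃ x₄ x₅,
          brT (ν x₁ x₂ x₃) (α x₄) (α x₅) - brT (ν x₁ x₂ x₄) (α x₃) (α x₅) -
                brT (α x₁) (α x₂) (ν x₃ x₄ x₅) + brT (α x₃) (α x₄) (ν x₁ x₂ x₅) +
              ν (brT x₁ x₂ x₃) (α x₄) (α x₅) + ν (α x₃) (brT x₁ x₂ x₄) (α x₅) +
              ν (α x₃) (α x₄) (brT x₁ x₂ x₅) -
            ν (α x₁) (α x₂) (brT x₃ x₄ x₅) = F x₁ x₂ x₃ x₄ x₅)) :
    -- every invariant 3-cocycle `μ₁` is the infinitesimal of an equivariant deformation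
    ∀ μ₁ : T →ₗ[K] T →ₗ[K] T →ₗ[K] T,
      (∀ (g : G) (a b c : T), μ₁ (g • a) (g • b) (g • c) = g • μ₁ a b c) →
      (∀ a b c, μ₁ (α a) (α b) (α c) = α (μ₁ a b c)) →
      (∀ a b, μ₁ a a b = 0) →
      (∀ a b c, μ₁ a b c + μ₁ b c a + μ₁ c a b = 0) →
      (∀ x₁ x₂ x₃ x₄ x₅,
        brT (μ₁ x₁ x₂ x₃) (α x₄) (α x₅) - brT (μ₁ x₁ x₂ x₄) (α x₃) (α x₅) -
              brT (α x₁) (α x₂) (μ₁ x₃ x₄ x₅) + brT (α x₃) (α x₄) (μ₁ x₁ x₂ x₅) +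
            μ₁ (brT x₁ x₂ x₃) (α x₄) (α x₅) + μ₁ (α x₃) (brT x₁ x₂ x₄) (α x₅) +
            μ₁ (α x₃) (α x₄) (brT x₁ x₂ x₅) -
          μ₁ (α x₁) (α x₂) (brT x₃ x₄ x₅) = 0) →
      ∃ μ : ℕ → T →ₗ[K] T →ₗ[K] T →ₗ[K] T,
        μ 0 = brT ∧ μ 1 = μ₁ ∧
        (∀ (i : ℕ) (g : G) (a b c : T),
          μ i (g • a) (g • b) (g • c) = g • μ i a b c) ∧
        (∀ r a b c, μ r (α a) (α b) (α c) = α (μ r a b c)) ∧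
        (∀ r a b, μ r a a b = 0) ∧
        (∀ r a b c, μ r a b c + μ r b c a + μ r c a b = 0) ∧
        (∀ r a b c d e,
          ∑ i ∈ Finset.range (r + 1), μ i (α a) (α b) (μ (r - i) c d e) =
            ∑ i ∈ Finset.range (r + 1),
              (μ i (μ (r - i) a b c) (α d) (α e) +
                μ i (α c) (μ (r - i) a b d) (α e) +
                μ i (α c) (α d) (μ (r - i) a b e))) := by
  classical
  intro μ₁ c1 c2 c3 c4 c5
  have hbr : IsC G α brT := ⟨fun g a b c => (hTact g a b c).symm,
    fun a b c => (hTmul a b c).symm, hT1, hT2⟩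
  have hμ₁ : IsC G α μ₁ := ⟨c1, c2, c3, c4⟩
  have h0C : IsC G α (0 : T →ₗ[K] T →ₗ[K] T →ₗ[K] T) := by
    refine ⟨?_, ?_, ?_, ?_⟩ <;> intros <;> simp
  -- the relation between `δ³` and `J5`
  have hδ : ∀ (ν : T →ₗ[K] T →ₗ[K] T →ₗ[K] T) (x₁ x₂ x₃ x₄ x₅ : T),
      J5 α brT ν x₁ x₂ x₃ x₄ x₅ + J5 α ν brT x₁ x₂ x₃ x₄ x₅ =
      -(brT (ν x₁ x₂ x₃) (α x₄) (α x₅) - brT (ν x₁ x₂ x₄) (α x₃) (α x₅) -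
                brT (α x₁) (α x₂) (ν x₃ x₄ x₅) + brT (α x₃) (α x₄) (ν x₁ x₂ x₅) +
              ν (brT x₁ x₂ x₃) (α x₄) (α x₅) + ν (α x₃) (brT x₁ x₂ x₄) (α x₅) +
              ν (α x₃) (α x₄) (brT x₁ x₂ x₅) -
            ν (α x₁) (α x₂) (brT x₃ x₄ x₅)) := by
    intro ν x₁ x₂ x₃ x₄ x₅
    rw [J5_apply, J5_apply, tri_neg brT hT1 (ν x₁ x₂ x₄)]
    abel
  -- the obstruction step
  have key : ∀ (r : ℕ) (g : ℕ → T →ₗ[K] T →ₗ[K] T →ₗ[K] T), g 0 = brT →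
      (∀ i, IsC G α (g i)) →
      (∀ s < r, ∑ y ∈ Finset.HasAntidiagonal.antidiagonal s, J5 α (g y.1) (g y.2) = 0) →
      ∃ ν, IsC G α ν ∧ J5 α brT ν + J5 α ν brT +
        ∑ y ∈ Finset.HasAntidiagonal.antidiagonal r, J5 α (g y.1) (g y.2) = 0 := by
    intro r g hg0 hgC hs
    obtain ⟨ν, n1, n2, n3, n4, n5⟩ := hH5
      (∑ y ∈ Finset.HasAntidiagonal.antidiagonal r, J5 α (g y.1) (g y.2))
      (by
        intro x₁ x₂ x₃ x₄ x₅
        simp only [LinearMap.sum_apply, map_sum, J5_alpha (G := G) α _ _ (hgC _) (hgC _)])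
      (by
        intro x₁ x₂ x y
        simp only [LinearMap.sum_apply, J5_alt (G := G) α _ _ (hgC _) (hgC _),
          Finset.sum_const_zero])
      (by
        intro x₁ x₂ x y z
        simp only [LinearMap.sum_apply, ← Finset.sum_add_distrib,
          J5_cyc (G := G) α _ _ (hgC _) (hgC _), Finset.sum_const_zero])
      (by
        intro g x₁ x₂ x₃ x₄ x₅
        simp only [LinearMap.sum_apply, J5_act α _ _ hTα (hgC _) (hgC _), Finset.smul_sum])
      (by
        intro x₁ x₂ x₃ x₄ x₅ x₆ x₇
        have := total α g (fun i => (hgC i).2.2.1) (fun i => (hgC i).2.1) r hs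
          x₁ x₂ x₃ x₄ x₅ x₆ x₇
        rw [hg0] at this
        rw [← this]
        unfold dA dB
        abel)
    refine ⟨ν, ⟨n1, n2, n3, n4⟩, ?_⟩
    ext x₁ x₂ x₃ x₄ x₅
    simp only [LinearMap.add_apply, hδ, n5, LinearMap.zero_apply]
    simp
  -- recursive construction
  let P : ℕ → (ℕ → T →ₗ[K] T →ₗ[K] T →ₗ[K] T) → (T →ₗ[K] T →ₗ[K] T →ₗ[K] T) → Prop :=
    fun r g ν => IsC G α ν ∧ J5 α brT ν + J5 α ν brT +
        ∑ y ∈ Finset.HasAntidiagonal.antidiagonal r, J5 α (g y.1) (g y.2) = 0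
  obtain ⟨f, hf⟩ := exists_rec (0 : T →ₗ[K] T →ₗ[K] T →ₗ[K] T)
    (fun r g => if r = 0 then brT else if r = 1 then μ₁ else
      if h : ∃ ν, P r g ν then h.choose else 0)
  have hf0 : f 0 = brT := by rw [hf]; simp
  have hf1 : f 1 = μ₁ := by rw [hf]; simp
  have main : ∀ r, IsC G α (f r) ∧
      ∑ y ∈ Finset.HasAntidiagonal.antidiagonal r, J5 α (f y.1) (f y.2) = 0 := by
    intro r
    induction r using Nat.strong_induction_on with
    | _ r ih =>
      match r, ih with
      | 0, _ =>
        refine ⟨hf0 ▸ hbr, ?_⟩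
        ext a b c d e
        rw [Finset.Nat.antidiagonal_zero, Finset.sum_singleton, hf0, J5_apply, ← hT3, sub_self]
        rfl
      | 1, _ =>
        refine ⟨hf1 ▸ hμ₁, ?_⟩
        ext a b c d e
        rw [Finset.Nat.sum_antidiagonal_succ, Finset.Nat.antidiagonal_zero, Finset.sum_singleton]
        simp only [zero_add, hf0, hf1, LinearMap.add_apply]
        rw [hδ, c5]
        simp
      | k + 2, ih =>
        set g : ℕ → T →ₗ[K] T →ₗ[K] T →ₗ[K] T := fun i => if i < k + 2 then f i else 0 with hg
        have hgf : ∀ i, i < k + 2 → g i = f i := fun i hi => by simp [hg, hi]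
        have hgr : g (k + 2) = 0 := by simp [hg]
        have hex : ∃ ν, P (k + 2) g ν := by
          refine key (k + 2) g (by rw [hgf 0 (by omega), hf0]) ?_ ?_
          · intro i
            by_cases hi : i < k + 2
            · rw [hgf i hi]; exact (ih i hi).1
            · simp only [hg, hi, if_false]; exact h0C
          · intro s hs
            rw [← (ih s hs).2]
            refine Finset.sum_congr rfl fun y hy => ?_
            have : y.1 + y.2 = s := by simpa using hy
            rw [hgf _ (by omega), hgf _ (by omega)]
        have hfr : f (k + 2) = hex.choose := by
          rw [hf]
          simp only [show k + 2 ≠ 0 by omega, show k + 2 ≠ 1 by omega, if_false]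
          exact dif_pos hex
        have hP : P (k + 2) g (f (k + 2)) := hfr ▸ hex.choose_spec
        refine ⟨hP.1, ?_⟩
        rw [← hP.2, Finset.Nat.antidiagonal_succ_succ']
        simp only [Finset.sum_cons, Finset.sum_map]
        rw [hgr, J5_zero_left, J5_zero_right, zero_add, zero_add, hf0, add_assoc]
        congr 2
        refine Finset.sum_congr rfl fun y hy => ?_
        have : y.1 + y.2 = k := by simpa using hy
        simp only [Function.Embedding.coe_prodMap, Function.Embedding.coeFn_mk, Prod.map_fst,
          Prod.map_snd]
        rw [hgf _ (by omega), hgf _ (by omega)]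
  refine ⟨f, hf0, hf1, fun i => (main i).1.1, fun i => (main i).1.2.1, fun i => (main i).1.2.2.1,
    fun i => (main i).1.2.2.2, ?_⟩
  intro r a b c d e
  have h := (main r).2
  rw [Finset.Nat.sum_antidiagonal_eq_sum_range_succ_mk] at h
  have h' := congrArg (fun F => F a b c d e) h
  simp only [LinearMap.sum_apply, J5_apply, LinearMap.zero_apply, Finset.sum_sub_distrib] at h'
  exact sub_eq_zero.mp h'
end
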